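/- arXiv:1505.01047 — 2 statements merged into one kernel-verified Lean document; each statement's English description precedes it below -/
import Mathlib

section
/- Let m ∈ (1/2)ℤ_{>0}, s, s₁ ∈ ℤ, and s′, s′₁ ∈ 1/2 + ℤ. For a function F of (τ, z₁, z₂) define (F|_S)(τ, z₁, z₂) = τ^{−1} e^{−2πi m z₁ z₂/τ} F(−1/τ, z₁/τ, z₂/τ). Then each of the four functions Φ^{+[m;s]} − Φ^{+[m;s₁]}|_S, Φ^{−[m;s]} − Φ^{+[m;s′]}|_S, Φ^{+[m;s′]} − Φ^{−[m;s]}|_S, and Φ^{−[m;s′]} − Φ^{−[m;s′₁]}|_S, a priori defined for Im τ > 0 and z₁ ∉ ℤ + ℤτ, extends to a holomorphic function on the domain X₀ = {(τ, z₁, z₂) ∈ ℂ³ : Im τ > 0}. -/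
noncomputable section

open Complex

/-- `mexp w = e^{2πi w}`. -/
def mexp (w : ℂ) : ℂ := Complex.exp (2 * (Real.pi : ℂ) * Complex.I * w)

/-- The signed mock theta function `Φ^{sgn[m;s]}(τ,z₁,z₂)`. -/
def PhiS (sgn : ℂ) (m s : ℝ) (τ z₁ z₂ : ℂ) : ℂ :=
  ∑' n : ℤ, sgn ^ n *
    mexp ((m : ℂ) * n * (z₁ + z₂) + (s : ℂ) * z₁ + τ * ((m : ℂ) * n ^ 2 + (s : ℂ) * n)) /
    (1 - mexp (z₁ + n * τ))

/-- The signed theta function `Θ^{sgn}_{j,m}(τ,z)`. -/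
def ThetaS (sgn : ℂ) (j m : ℝ) (τ z : ℂ) : ℂ :=
  ∑' n : ℤ, sgn ^ n *
    mexp ((m : ℂ) * z * ((n : ℂ) + ((j / (2 * m) : ℝ) : ℂ)) +
      τ * (m : ℂ) * ((n : ℂ) + ((j / (2 * m) : ℝ) : ℂ)) ^ 2)

/-- `E(x) = 2∫₀ˣ e^{-πu²} du`. -/
def Efun (x : ℝ) : ℝ := 2 * ∫ u in (0:ℝ)..x, Real.exp (-Real.pi * u ^ 2)

/-- `ψ_{m,n}(τ,z) = (n - 2m Im z / Im τ) √(Im τ / m)`. -/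
def psiMN (m n : ℝ) (τ z : ℂ) : ℝ := (n - 2 * m * z.im / τ.im) * Real.sqrt (τ.im / m)

/-- The real-analytic correction `R^{sgn}_{j,m}(τ,z)`; the summation variable `n ∈ j + 2mℤ`
is written as `n = j + 2mk`, `k ∈ ℤ`, so that `(±1)^{(n-j)/(2m)} = sgn^k`. -/
def RS (sgn : ℂ) (j m : ℝ) (τ z : ℂ) : ℂ :=
  ∑' k : ℤ, sgn ^ k *
    (((Real.sign (j + 2 * m * k - 1 / 2 - j + 2 * m) -
        Efun (psiMN m (j + 2 * m * k) τ z) : ℝ)) : ℂ) *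
    Complex.exp (-(Real.pi : ℂ) * Complex.I * (((j + 2 * m * k : ℝ)) : ℂ) ^ 2 * τ / (2 * (m : ℂ))
      + 2 * (Real.pi : ℂ) * Complex.I * (((j + 2 * m * k : ℝ)) : ℂ) * z)

/-- The modifier `Φ^{sgn[m;s]}_add`; the summation variable `j ∈ s + ℤ`, `s ≤ j < s + 2m`
is written as `j = s + i`, `0 ≤ i < ⌈2m⌉`. -/
def PhiAddS (sgn : ℂ) (m s : ℝ) (τ z₁ z₂ : ℂ) : ℂ :=
  ∑ i ∈ Finset.range ⌈2 * m⌉₊,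
    RS sgn (s + i) m τ ((z₁ - z₂) / 2) * ThetaS sgn (s + i) m τ (z₁ + z₂)

/-- The modified (signed) mock theta function `Φ̃^{sgn[m;s]}`. -/
def PhiTilde (sgn : ℂ) (m s : ℝ) (τ z₁ z₂ : ℂ) : ℂ :=
  PhiS sgn m s τ z₁ z₂ - (1 / 2) * PhiAddS sgn m s τ z₁ z₂

end

/-- The weight-1, degree-m `S`-transform `F ↦ F|_S` of a function of `(τ, z₁, z₂)`. -/
noncomputable def SAct (m : ℝ) (F : ℂ → ℂ → ℂ → ℂ) (τ z₁ z₂ : ℂ) : ℂ :=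
  τ⁻¹ * Complex.exp (-(2 * (Real.pi : ℂ) * Complex.I) * (m : ℂ) * z₁ * z₂ / τ) *
    F (-1 / τ) (z₁ / τ) (z₂ / τ)

open Filter Topology

section Gluing

variable {E : Type*} [NormedAddCommGroup E] [NormedSpace ℂ E]

/-- A function that is given off a set `Z` with dense complement and agrees there locally with
holomorphic functions extends to a holomorphic function. -/
theorem exists_differentiableOn_extension {U Z : Set E} (f : E → ℂ)
    (hZ : ∀ p ∈ U, p ∈ closure Zᶜ) (hU : IsOpen U)
    (h : ∀ p ∈ U, ∃ g : E → ℂ, ∀ᶠ q in 𝓝 p, DifferentiableAt ℂ g q ∧ (q ∉ Z → f q = g q)) :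
    ∃ G : E → ℂ, DifferentiableOn ℂ G U ∧ ∀ p ∈ U, p ∉ Z → G p = f p := by
  have key : ∀ p ∈ U, ∀ g : E → ℂ,
      (∀ᶠ q in 𝓝 p, DifferentiableAt ℂ g q ∧ (q ∉ Z → f q = g q)) →
      limUnder (𝓝[Zᶜ] p) f = g p := by
    intro p hp g hg
    have : (𝓝[Zᶜ] p).NeBot := mem_closure_iff_nhdsWithin_neBot.1 (hZ p hp)
    have hlim : Tendsto g (𝓝[Zᶜ] p) (𝓝 (g p)) :=
      hg.self_of_nhds.1.continuousAt.tendsto.mono_left nhdsWithin_le_nhds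
    refine (hlim.congr' ?_).limUnder_eq
    filter_upwards [nhdsWithin_le_nhds hg, self_mem_nhdsWithin] with q hq hqZ
    exact (hq.2 hqZ).symm
  refine ⟨fun p => limUnder (𝓝[Zᶜ] p) f, fun p hp => ?_, fun p hp hpZ => ?_⟩
  · obtain ⟨g, hg⟩ := h p hp
    have heq : (fun p => limUnder (𝓝[Zᶜ] p) f) =ᶠ[𝓝 p] g := by
      filter_upwards [eventually_eventually_nhds.2 hg, hU.mem_nhds hp] with q hq hqU
      exact key q hqU g hq
    exact (hg.self_of_nhds.1.congr_of_eventuallyEq heq).differentiableWithinAt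
  · obtain ⟨g, hg⟩ := h p hp
    exact (key p hp g hg).trans (hg.self_of_nhds.2 hpZ).symm

/-- A locally normally convergent series of holomorphic functions is holomorphic. -/
theorem eventually_differentiableAt_tsum {ι : Type*} {f : ι → E → ℂ} {u : ι → ℝ} {p : E}
    (hu : Summable u)
    (h : ∀ᶠ q in 𝓝 p, ∀ i, DifferentiableAt ℂ (f i) q ∧ ‖f i q‖ ≤ u i) :
    ∀ᶠ q in 𝓝 p, DifferentiableAt ℂ (fun q => ∑' i, f i q) q := by
  obtain ⟨r, hr, hball⟩ := Metric.eventually_nhds_iff_ball.1 h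
  have hr2 : 0 < r / 2 := by positivity
  have hsub : ∀ x ∈ Metric.ball p (r / 2), Metric.ball x (r / 2) ⊆ Metric.ball p r := by
    intro x hx y hy
    rw [Metric.mem_ball] at *
    linarith [dist_triangle y x p]
  have hsub' : Metric.ball p (r / 2) ⊆ Metric.ball p r := Metric.ball_subset_ball (by linarith)
  filter_upwards [Metric.ball_mem_nhds p hr2] with x hx
  refine (hasFDerivAt_tsum_of_isPreconnected (u := fun i => 2 * u i / (r / 2))
    ((hu.mul_left 2).div_const _) Metric.isOpen_ball (convex_ball p (r / 2)).isPreconnected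
    (fun i y hy => (hball y (hsub' hy) i).1.hasFDerivAt) (fun i y hy => ?_) hx
    (hu.of_norm_bounded fun i => (hball x (hsub' hx) i).2) hx).differentiableAt
  refine Complex.norm_fderiv_le_div_of_mapsTo_ball
    (fun z hz => (hball z (hsub y hy hz) i).1.differentiableWithinAt) (fun z hz => ?_) hr2
  rw [Metric.mem_closedBall, dist_eq_norm]
  linarith [norm_sub_le (f i z) (f i y), (hball z (hsub y hy hz) i).2, (hball y (hsub' hy) i).2]

/-- Finitely many terms of a locally normally convergent series need no uniform bound. -/
theorem eventually_summable_and_differentiableAt_tsum {ι : Type*} {f : ι → E → ℂ} {u : ι → ℝ}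
    {p : E} (hu : Summable u) (t : Finset ι)
    (h : ∀ᶠ q in 𝓝 p, ∀ i ∉ t, DifferentiableAt ℂ (f i) q ∧ ‖f i q‖ ≤ u i)
    (ht : ∀ i ∈ t, ∀ᶠ q in 𝓝 p, DifferentiableAt ℂ (f i) q) :
    ∀ᶠ q in 𝓝 p, Summable (fun i => f i q) ∧ DifferentiableAt ℂ (fun q => ∑' i, f i q) q := by
  classical
  let v : ι → ℝ := fun i => if i ∈ t then ‖f i p‖ + 1 else u i
  have hv : Summable v := by
    refine (summable_congr_cofinite ?_).1 hu
    filter_upwards [t.finite_toSet.compl_mem_cofinite] with i hi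
    exact (if_neg hi).symm
  have hfin : ∀ᶠ q in 𝓝 p, ∀ i ∈ t, DifferentiableAt ℂ (f i) q ∧ ‖f i q‖ ≤ v i := by
    refine (eventually_all_finset t).2 fun i hi => ?_
    filter_upwards [ht i hi, (ht i hi).self_of_nhds.continuousAt.norm.eventually
      (eventually_le_nhds (lt_add_one ‖f i p‖))] with q hq hq'
    exact ⟨hq, by simpa only [v, if_pos hi] using hq'⟩
  have hall : ∀ᶠ q in 𝓝 p, ∀ i, DifferentiableAt ℂ (f i) q ∧ ‖f i q‖ ≤ v i := by
    filter_upwards [h, hfin] with q hq hq' i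
    by_cases hi : i ∈ t
    · exact hq' i hi
    · simpa only [v, if_neg hi] using hq i hi
  filter_upwards [hall, eventually_differentiableAt_tsum hv hall] with q hq hq'
  exact ⟨hv.of_norm_bounded fun i => (hq i).2, hq'⟩

end Gluing

section Exponential

theorem mexp_add (x y : ℂ) : mexp (x + y) = mexp x * mexp y := by
  simp only [mexp, mul_add, Complex.exp_add]

theorem mexp_zpow (x : ℂ) (n : ℤ) : mexp x ^ n = mexp (n * x) := by
  rw [mexp, mexp, ← Complex.exp_int_mul]
  ring_nf

theorem mexp_intCast (n : ℤ) : mexp n = 1 := by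
  rw [mexp, mul_comm, Complex.exp_int_mul_two_pi_mul_I]

theorem mexp_add_intCast (x : ℂ) (n : ℤ) : mexp (x + n) = mexp x := by
  rw [mexp_add, mexp_intCast, mul_one]

theorem mexp_intCast_add_half (n : ℤ) : mexp (n + 1 / 2) = -1 := by
  rw [mexp_add, mexp_intCast, one_mul, mexp]
  rw [show 2 * (Real.pi : ℂ) * Complex.I * (1 / 2) = Real.pi * Complex.I by ring,
    Complex.exp_pi_mul_I]

theorem mexp_eq_one_iff (x : ℂ) : mexp x = 1 ↔ ∃ n : ℤ, x = n := by
  rw [mexp, Complex.exp_eq_one_iff]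
  refine exists_congr fun n => ?_
  rw [mul_comm, mul_left_inj' Complex.two_pi_I_ne_zero]

theorem norm_mexp (x : ℂ) : ‖mexp x‖ = Real.exp (-(2 * Real.pi * x.im)) := by
  rw [mexp, Complex.norm_exp]
  simp

theorem differentiable_mexp : Differentiable ℂ mexp := by
  unfold mexp
  fun_prop

@[fun_prop]
theorem DifferentiableAt.mexp {E : Type*} [NormedAddCommGroup E] [NormedSpace ℂ E] {f : E → ℂ}
    {p : E} (hf : DifferentiableAt ℂ f p) : DifferentiableAt ℂ (fun q => mexp (f q)) p :=
  (differentiable_mexp _).comp p hf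

theorem half_le_norm_one_sub_mexp {x : ℂ} (hx : 1 ≤ |x.im|) : 1 / 2 ≤ ‖1 - mexp x‖ := by
  have hpi := Real.pi_gt_three
  rcases le_abs.1 hx with h | h
  · have h1 : ‖mexp x‖ ≤ 1 / 2 := by
      rw [norm_mexp, Real.exp_neg, one_div]
      refine inv_anti₀ (by norm_num) ?_
      nlinarith [Real.add_one_le_exp (2 * Real.pi * x.im)]
    have h2 := norm_sub_norm_le 1 (mexp x)
    rw [norm_one] at h2
    linarith
  · have h1 : 2 ≤ ‖mexp x‖ := by
      rw [norm_mexp]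
      nlinarith [Real.add_one_le_exp (-(2 * Real.pi * x.im))]
    have h2 := norm_sub_norm_le (mexp x) 1
    rw [norm_one, norm_sub_rev] at h2
    linarith

end Exponential

section Series

/-- The `n`-th term of the series `PhiS`, as a function on `ℂ³`. -/
noncomputable def phiTerm (ε : ℂ) (m s : ℝ) (n : ℤ) (p : ℂ × ℂ × ℂ) : ℂ :=
  ε ^ n * mexp ((m : ℂ) * n * (p.2.1 + p.2.2) + (s : ℂ) * p.2.1 +
    p.1 * ((m : ℂ) * n ^ 2 + (s : ℂ) * n)) / (1 - mexp (p.2.1 + n * p.1))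

theorem differentiableAt_phiTerm (ε : ℂ) (m s : ℝ) (n : ℤ) {p : ℂ × ℂ × ℂ}
    (hp : 1 - mexp (p.2.1 + n * p.1) ≠ 0) : DifferentiableAt ℂ (phiTerm ε m s n) p := by
  unfold phiTerm
  fun_prop (disch := exact hp)

theorem eventually_differentiableAt_phiTerm (ε : ℂ) (m s : ℝ) (n : ℤ) {p : ℂ × ℂ × ℂ}
    (hp : ∀ a : ℤ, p.2.1 + n * p.1 ≠ a) :
    ∀ᶠ q in 𝓝 p, DifferentiableAt ℂ (phiTerm ε m s n) q := by
  have hcont : ContinuousAt (fun q : ℂ × ℂ × ℂ => 1 - mexp (q.2.1 + n * q.1)) p :=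
    DifferentiableAt.continuousAt (𝕜 := ℂ) (by fun_prop)
  have hne : 1 - mexp (p.2.1 + n * p.1) ≠ 0 := by
    rw [sub_ne_zero, ne_comm, Ne, mexp_eq_one_iff]
    exact fun ⟨a, ha⟩ => hp a ha
  filter_upwards [hcont.eventually_ne hne] with q hq
  exact differentiableAt_phiTerm ε m s n hq

theorem mexp_eq_mul_jacobiTheta₂_term (m s τ z₁ z₂ : ℂ) (n : ℤ) :
    mexp (m * n * (z₁ + z₂) + s * z₁ + τ * (m * n ^ 2 + s * n)) =
      mexp (s * z₁) * jacobiTheta₂_term n (m * (z₁ + z₂) + s * τ) (2 * m * τ) := by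
  rw [mexp, mexp, jacobiTheta₂_term, ← Complex.exp_add]
  ring_nf

/-- Near every point, the terms of the series `PhiS` with large index are holomorphic and dominated
by a convergent series. -/
theorem exists_summable_bound_phiTerm {ε : ℂ} (hε : ‖ε‖ = 1) {m : ℝ} (hm : 0 < m) (s : ℝ)
    {p : ℂ × ℂ × ℂ} (hp : 0 < p.1.im) :
    ∃ u : ℤ → ℝ, Summable u ∧ (∀ n, 0 ≤ u n) ∧ ∃ t : Finset ℤ, ∀ᶠ q in 𝓝 p, ∀ n ∉ t,
      DifferentiableAt ℂ (phiTerm ε m s n) q ∧ ‖phiTerm ε m s n q‖ ≤ u n := by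
  obtain ⟨N, hN⟩ := exists_nat_ge ((|p.2.1.im| + 2) / (p.1.im / 2))
  rw [div_le_iff₀ (by positivity)] at hN
  set S := |((m : ℂ) * (p.2.1 + p.2.2) + s * p.1).im| + 1
  set K := ‖mexp (s * p.2.1)‖ + 1
  refine ⟨fun n => 2 * (K * Real.exp (-Real.pi * (m * p.1.im * n ^ 2 - 2 * S * |n|))), ?_, ?_,
    Finset.Icc (-N) N, ?_⟩
  · have := summable_pow_mul_jacobiTheta₂_term_bound S (mul_pos hm hp) 0
    simp only [pow_zero, one_mul] at this
    exact (this.mul_left K).mul_left 2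
  · intro n
    positivity
  have h1 : ∀ᶠ q : ℂ × ℂ × ℂ in 𝓝 p, p.1.im / 2 < q.1.im :=
    (show ContinuousAt (fun q : ℂ × ℂ × ℂ => q.1.im) p by fun_prop).eventually
      (lt_mem_nhds (half_lt_self hp))
  have h2 : ∀ᶠ q : ℂ × ℂ × ℂ in 𝓝 p, |q.2.1.im| < |p.2.1.im| + 1 :=
    (show ContinuousAt (fun q : ℂ × ℂ × ℂ => |q.2.1.im|) p by fun_prop).eventually
      (gt_mem_nhds (lt_add_one _))
  have h3 : ∀ᶠ q : ℂ × ℂ × ℂ in 𝓝 p, |((m : ℂ) * (q.2.1 + q.2.2) + s * q.1).im| < S :=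
    (show ContinuousAt
      (fun q : ℂ × ℂ × ℂ => |((m : ℂ) * (q.2.1 + q.2.2) + s * q.1).im|) p by fun_prop).eventually
      (gt_mem_nhds (lt_add_one _))
  have h4 : ∀ᶠ q : ℂ × ℂ × ℂ in 𝓝 p, ‖mexp (s * q.2.1)‖ < K :=
    (show ContinuousAt (fun q : ℂ × ℂ × ℂ => ‖mexp (s * q.2.1)‖) p from
      (DifferentiableAt.continuousAt (𝕜 := ℂ) (by fun_prop)).norm).eventually
      (gt_mem_nhds (lt_add_one _))
  filter_upwards [h1, h2, h3, h4] with q h1 h2 h3 h4 n hn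
  have hNn : (N : ℝ) ≤ |(n : ℝ)| := by
    rw [Finset.mem_Icc, ← abs_le, not_le] at hn
    exact_mod_cast hn.le
  have him : 1 ≤ |(q.2.1 + n * q.1).im| := by
    have e : (q.2.1 + n * q.1).im = q.2.1.im + n * q.1.im := by simp
    have h5 : |(n : ℝ) * q.1.im| = |(n : ℝ)| * q.1.im := by
      rw [abs_mul, abs_of_pos (a := q.1.im) (by linarith)]
    have h6 := abs_sub_abs_le_abs_sub ((n : ℝ) * q.1.im) (-q.2.1.im)
    rw [abs_neg, sub_neg_eq_add, h5, add_comm ((n : ℝ) * q.1.im), ← e] at h6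
    have h7 : (N : ℝ) * (p.1.im / 2) ≤ |(n : ℝ)| * q.1.im :=
      mul_le_mul hNn h1.le (by positivity) (abs_nonneg _)
    linarith
  have hden := half_le_norm_one_sub_mexp him
  refine ⟨differentiableAt_phiTerm ε m s n (norm_pos_iff.1 (by linarith)), ?_⟩
  rw [phiTerm, mexp_eq_mul_jacobiTheta₂_term, norm_div, norm_mul, norm_zpow, hε, one_zpow, one_mul,
    norm_mul, div_le_iff₀ (by linarith)]
  have hT : m * p.1.im ≤ (2 * (m : ℂ) * q.1).im := by
    have : (2 * (m : ℂ) * q.1).im = 2 * m * q.1.im := by simp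
    rw [this]
    nlinarith
  have hθ := norm_jacobiTheta₂_term_le (mul_pos hm hp) h3.le hT n
  have hprod := mul_le_mul h4.le hθ (norm_nonneg _) (by positivity)
  have hnn : 0 ≤ K * Real.exp (-Real.pi * (m * p.1.im * n ^ 2 - 2 * S * |n|)) := by positivity
  push_cast at hprod hnn ⊢
  nlinarith

/-- Near a point where only the `n₀`-th term of `PhiS` may be singular, `PhiS` is this term plus a
holomorphic function. -/
theorem exists_PhiS_eq_phiTerm_add {ε : ℂ} (hε : ‖ε‖ = 1) {m : ℝ} (hm : 0 < m) (s : ℝ) (n₀ : ℤ)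
    {p : ℂ × ℂ × ℂ} (hp : 0 < p.1.im) (hn : ∀ n ≠ n₀, ∀ a : ℤ, p.2.1 + n * p.1 ≠ a) :
    ∃ T : ℂ × ℂ × ℂ → ℂ, ∀ᶠ q in 𝓝 p, DifferentiableAt ℂ T q ∧
      PhiS ε m s q.1 q.2.1 q.2.2 = phiTerm ε m s n₀ q + T q := by
  obtain ⟨u, hu, hu0, t, ht⟩ := exists_summable_bound_phiTerm hε hm s hp
  let f : ℤ → ℂ × ℂ × ℂ → ℂ := fun n q => if n = n₀ then 0 else phiTerm ε m s n q
  have hf₀ : f n₀ = fun _ => 0 := by simp [f]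
  have hf : ∀ n ≠ n₀, f n = phiTerm ε m s n := fun n h => by simp [f, h]
  refine ⟨fun q => ∑' n, f n q, ?_⟩
  have h := eventually_summable_and_differentiableAt_tsum (f := f) (p := p) hu t ?_ ?_
  · filter_upwards [h] with q hq
    refine ⟨hq.2, ?_⟩
    have hs : Summable fun n => phiTerm ε m s n q := by
      refine (summable_congr_cofinite ?_).1 hq.1
      filter_upwards [(Set.finite_singleton n₀).compl_mem_cofinite] with n hn
      rw [hf n hn]
    exact hs.tsum_eq_add_tsum_ite n₀
  · filter_upwards [ht] with q hq n hnt
    rcases eq_or_ne n n₀ with rfl | hne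
    · rw [hf₀]
      exact ⟨differentiableAt_const _, by simpa using hu0 n⟩
    · rw [hf n hne]
      exact hq n hnt
  · intro n _
    rcases eq_or_ne n n₀ with rfl | hne
    · rw [hf₀]
      exact Eventually.of_forall fun q => differentiableAt_const _
    · rw [hf n hne]
      exact eventually_differentiableAt_phiTerm ε m s n (hn n hne)

end Series

section Singularity

/-- The entire function `(eˣ - 1) / x`. -/
noncomputable def expSlope : ℂ → ℂ := dslope Complex.exp 0

/-- The entire function `(eˣ - 1 - x) / x²`. -/
noncomputable def expSlope₂ : ℂ → ℂ := dslope expSlope 0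

theorem differentiable_dslope {f : ℂ → ℂ} (hf : Differentiable ℂ f) (c : ℂ) :
    Differentiable ℂ (dslope f c) :=
  differentiableOn_univ.1
    ((Complex.differentiableOn_dslope Filter.univ_mem).2 hf.differentiableOn)

theorem differentiable_expSlope : Differentiable ℂ expSlope :=
  differentiable_dslope Complex.differentiable_exp 0

theorem differentiable_expSlope₂ : Differentiable ℂ expSlope₂ :=
  differentiable_dslope differentiable_expSlope 0

theorem expSlope_zero : expSlope 0 = 1 := by
  rw [expSlope, dslope_same, Complex.deriv_exp, Complex.exp_zero]

theorem exp_eq_one_add_mul_expSlope (x : ℂ) : Complex.exp x = 1 + x * expSlope x := by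
  have := sub_smul_dslope Complex.exp 0 x
  rw [sub_zero, smul_eq_mul, Complex.exp_zero] at this
  rw [expSlope, this]
  ring

theorem expSlope_eq_one_add_mul_expSlope₂ (x : ℂ) : expSlope x = 1 + x * expSlope₂ x := by
  have := sub_smul_dslope expSlope 0 x
  rw [sub_zero, smul_eq_mul, expSlope_zero] at this
  rw [expSlope₂, this]
  ring

/-- The regular part at `w = 0` of `e^{2πiαw} / (1 - e^{2πiw})`. -/
noncomputable def mexpQuotReg (α w : ℂ) : ℂ :=
  (expSlope₂ (2 * Real.pi * Complex.I * w) -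
    α * expSlope (2 * Real.pi * Complex.I * (α * w))) / expSlope (2 * Real.pi * Complex.I * w)

theorem mexp_div_one_sub_mexp (α : ℂ) {w : ℂ} (hw : w ≠ 0)
    (hw' : expSlope (2 * Real.pi * Complex.I * w) ≠ 0) :
    mexp (α * w) / (1 - mexp w) = mexpQuotReg α w - 1 / (2 * Real.pi * Complex.I * w) := by
  have hx : 2 * Real.pi * Complex.I * w ≠ 0 := mul_ne_zero Complex.two_pi_I_ne_zero hw
  rw [mexpQuotReg, mexp, mexp,
    show 2 * Real.pi * Complex.I * (α * w) = α * (2 * Real.pi * Complex.I * w) by ring]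
  set x := 2 * Real.pi * Complex.I * w
  rw [exp_eq_one_add_mul_expSlope (α * x), exp_eq_one_add_mul_expSlope x]
  have h2 := expSlope_eq_one_add_mul_expSlope₂ x
  have hden : 1 - (1 + x * expSlope x) ≠ 0 := by
    rw [sub_add_cancel_left, neg_ne_zero]
    exact mul_ne_zero hx hw'
  rw [div_sub_div _ _ hw' hx, div_eq_div_iff hden (mul_ne_zero hw' hx)]
  linear_combination (-x * expSlope x) * h2

/-- The substitution `(τ, z₁, z₂) ↦ (-1/τ, z₁/τ, z₂/τ)`. -/
noncomputable def sMap (q : ℂ × ℂ × ℂ) : ℂ × ℂ × ℂ := (-1 / q.1, q.2.1 / q.1, q.2.2 / q.1)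

/-- The automorphy factor of `SAct`. -/
noncomputable def sFactor (m : ℝ) (q : ℂ × ℂ × ℂ) : ℂ :=
  q.1⁻¹ * Complex.exp (-(2 * (Real.pi : ℂ) * Complex.I) * (m : ℂ) * q.2.1 * q.2.2 / q.1)

theorem differentiableAt_sMap {q : ℂ × ℂ × ℂ} (hq : q.1 ≠ 0) : DifferentiableAt ℂ sMap q := by
  unfold sMap
  fun_prop (disch := exact hq)

theorem differentiableAt_sFactor (m : ℝ) {q : ℂ × ℂ × ℂ} (hq : q.1 ≠ 0) :
    DifferentiableAt ℂ (sFactor m) q := by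
  unfold sFactor
  fun_prop (disch := exact hq)

theorem sMap_fst_im_pos {q : ℂ × ℂ × ℂ} (hq : 0 < q.1.im) : 0 < (sMap q).1.im := by
  have hne : q.1 ≠ 0 := fun h => by simp [h] at hq
  rw [sMap, neg_div, one_div, Complex.neg_im, Complex.inv_im, neg_div, neg_neg]
  exact div_pos hq (Complex.normSq_pos.2 hne)

theorem eventually_fst_im_pos {p : ℂ × ℂ × ℂ} (hp : 0 < p.1.im) :
    ∀ᶠ q : ℂ × ℂ × ℂ in 𝓝 p, 0 < q.1.im :=
  (show ContinuousAt (fun q : ℂ × ℂ × ℂ => q.1.im) p by fun_prop).eventually (lt_mem_nhds hp)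

theorem phiTerm_eq_mexpQuotReg {m s t : ℝ} (n a : ℤ) {q : ℂ × ℂ × ℂ}
    (hw : q.2.1 + n * q.1 - a ≠ 0)
    (hw' : expSlope (2 * Real.pi * Complex.I * (q.2.1 + n * q.1 - a)) ≠ 0) :
    phiTerm (mexp t) m s n q =
      mexp (s * a + t * n + m * n * a + m * n * q.2.2) *
        (mexpQuotReg (m * n + s) (q.2.1 + n * q.1 - a) -
          1 / (2 * Real.pi * Complex.I * (q.2.1 + n * q.1 - a))) := by
  rw [← mexp_div_one_sub_mexp _ hw hw', phiTerm, mexp_zpow, ← mexp_add, ← mul_div_assoc,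
    ← mexp_add]
  congr 2
  · ring
  · rw [← mexp_add_intCast (_ - _) a, sub_add_cancel]

theorem sFactor_mul_phiTerm_eq_mexpQuotReg {m s t : ℝ} {M T : ℤ} (hM : 2 * m = M) (hT : 2 * t = T)
    (n a : ℤ) {q : ℂ × ℂ × ℂ} (hq : q.1 ≠ 0) (hw : q.2.1 + n * q.1 - a ≠ 0)
    (hw' : expSlope (2 * Real.pi * Complex.I * ((q.2.1 + n * q.1 - a) / q.1)) ≠ 0) :
    sFactor m q * phiTerm (mexp s) m t a (sMap q) =
      mexp (s * a + t * n + m * n * a + m * n * q.2.2) *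
        (q.1⁻¹ * mexpQuotReg (m * a + t - m * q.2.2) ((q.2.1 + n * q.1 - a) / q.1) -
          1 / (2 * Real.pi * Complex.I * (q.2.1 + n * q.1 - a))) := by
  have hM' : 2 * (m : ℂ) = M := by exact_mod_cast hM
  have hT' : 2 * (t : ℂ) = T := by exact_mod_cast hT
  have hpole : 1 / (2 * Real.pi * Complex.I * (q.2.1 + n * q.1 - a)) =
      q.1⁻¹ * (1 / (2 * Real.pi * Complex.I * ((q.2.1 + n * q.1 - a) / q.1))) := by
    field_simp
  have hnum : Complex.exp (-(2 * (Real.pi : ℂ) * Complex.I) * m * q.2.1 * q.2.2 / q.1) *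
      (mexp s ^ a * mexp (m * a * (q.2.1 / q.1 + q.2.2 / q.1) + t * (q.2.1 / q.1) +
        -1 / q.1 * (m * a ^ 2 + t * a))) =
      mexp (s * a + t * n + m * n * a + m * n * q.2.2) *
        mexp ((m * a + t - m * q.2.2) * ((q.2.1 + n * q.1 - a) / q.1)) := by
    rw [show -(2 * (Real.pi : ℂ) * Complex.I) * m * q.2.1 * q.2.2 / q.1 =
        2 * Real.pi * Complex.I * -(m * q.2.1 * q.2.2 / q.1) by ring, ← mexp, mexp_zpow,
      ← mexp_add, ← mexp_add, ← mexp_add, ← mexp_add_intCast _ (M * n * a + T * n)]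
    congr 1
    push_cast
    rw [← hM', ← hT']
    field_simp
    ring
  have hden : mexp (q.2.1 / q.1 + a * (-1 / q.1)) = mexp ((q.2.1 + n * q.1 - a) / q.1) := by
    rw [← mexp_add_intCast _ n]
    congr 1
    field_simp
    ring
  rw [hpole, ← mul_sub, ← mexp_div_one_sub_mexp _ (div_ne_zero hw hq) hw']
  simp only [phiTerm, sFactor, sMap]
  rw [hden]
  linear_combination (q.1⁻¹ / (1 - mexp ((q.2.1 + n * q.1 - a) / q.1))) * hnum

/-- The poles of corresponding terms of `PhiS` and of its `S`-transform cancel. -/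
theorem exists_phiTerm_sub_eq {m s t : ℝ} {M T : ℤ} (hM : 2 * m = M) (hT : 2 * t = T)
    (n a : ℤ) {p : ℂ × ℂ × ℂ} (hp : 0 < p.1.im) (hpa : p.2.1 = a - n * p.1) :
    ∃ g : ℂ × ℂ × ℂ → ℂ, ∀ᶠ q in 𝓝 p, DifferentiableAt ℂ g q ∧
      (q.2.1 ≠ a - n * q.1 →
        phiTerm (mexp t) m s n q - sFactor m q * phiTerm (mexp s) m t a (sMap q) = g q) := by
  have hp0 : p.1 ≠ 0 := fun h => by simp [h] at hp
  have hwp : p.2.1 + n * p.1 - a = 0 := by rw [hpa]; ring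
  refine ⟨fun q => mexp (s * a + t * n + m * n * a + m * n * q.2.2) *
    (mexpQuotReg (m * n + s) (q.2.1 + n * q.1 - a) -
      q.1⁻¹ * mexpQuotReg (m * a + t - m * q.2.2) ((q.2.1 + n * q.1 - a) / q.1)), ?_⟩
  have h1 : ContinuousAt (fun q : ℂ × ℂ × ℂ =>
      expSlope (2 * Real.pi * Complex.I * (q.2.1 + n * q.1 - a))) p :=
    (differentiable_expSlope.continuous.continuousAt).comp (by fun_prop)
  have h2 : ContinuousAt (fun q : ℂ × ℂ × ℂ =>
      expSlope (2 * Real.pi * Complex.I * ((q.2.1 + n * q.1 - a) / q.1))) p :=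
    (differentiable_expSlope.continuous.continuousAt).comp
      (by fun_prop (disch := exact hp0))
  have h1' := h1.eventually_ne (y := 0) (by simp [hwp, expSlope_zero])
  have h2' := h2.eventually_ne (y := 0) (by simp [hwp, expSlope_zero])
  filter_upwards [h1', h2', eventually_fst_im_pos hp] with q h1 h2 hq
  have hq0 : q.1 ≠ 0 := fun h => by simp [h] at hq
  constructor
  · have hE := differentiable_expSlope
    have hE₂ := differentiable_expSlope₂
    unfold mexpQuotReg
    fun_prop (disch := assumption)
  · intro hqa
    have hw : q.2.1 + n * q.1 - a ≠ 0 := fun h => hqa (by linear_combination h)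
    rw [phiTerm_eq_mexpQuotReg n a hw h1, sFactor_mul_phiTerm_eq_mexpQuotReg hM hT n a hq0 hw h2]
    ring

end Singularity

section Extension

/-- The points of `ℂ³` with `z₁ ∈ ℤ + ℤτ`. -/
def latticeDivisor : Set (ℂ × ℂ × ℂ) := {q | ∃ a b : ℤ, q.2.1 = a + b * q.1}

theorem dense_compl_latticeDivisor : Dense latticeDivisorᶜ := by
  rintro ⟨τ, z₁, z₂⟩
  have hcount : (Set.range fun x : ℤ × ℤ => (x.1 : ℂ) + x.2 * τ).Countable :=
    Set.countable_range _
  have hz : z₁ ∈ closure (Set.range fun x : ℤ × ℤ => (x.1 : ℂ) + x.2 * τ)ᶜ :=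
    hcount.dense_compl ℂ z₁
  have hcont : Continuous fun z : ℂ => (τ, z, z₂) := by fun_prop
  refine map_mem_closure (f := fun z : ℂ => (τ, z, z₂)) hcont hz fun z hz => ?_
  rintro ⟨a, b, hab⟩
  exact hz ⟨(a, b), hab.symm⟩

theorem intCast_add_mul_inj {τ : ℂ} (hτ : 0 < τ.im) {a b c d : ℤ}
    (h : (a : ℂ) + b * τ = c + d * τ) : a = c ∧ b = d := by
  have him := congrArg Complex.im h
  simp only [Complex.add_im, Complex.intCast_im, Complex.mul_im, Complex.intCast_re, zero_mul,
    add_zero, zero_add] at him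
  have hbd : b = d := by exact_mod_cast mul_right_cancel₀ hτ.ne' him
  subst hbd
  exact ⟨by exact_mod_cast add_right_cancel h, rfl⟩

/-- If only one term of `PhiS` and one term of its `S`-transform may be singular near a point and
their difference is regular there, then so is the difference of the full functions. -/
theorem exists_PhiS_sub_SAct_eq {m s t : ℝ} (hm : 0 < m) {n k : ℤ} {p : ℂ × ℂ × ℂ}
    {W : Set (ℂ × ℂ × ℂ)} (hp : 0 < p.1.im)
    (hn : ∀ l ≠ n, ∀ a : ℤ, p.2.1 + l * p.1 ≠ a)
    (hk : ∀ l ≠ k, ∀ a : ℤ, (sMap p).2.1 + l * (sMap p).1 ≠ a)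
    (h : ∃ g : ℂ × ℂ × ℂ → ℂ, ∀ᶠ q in 𝓝 p, DifferentiableAt ℂ g q ∧
      (q ∉ W → phiTerm (mexp t) m s n q - sFactor m q * phiTerm (mexp s) m t k (sMap q) = g q)) :
    ∃ g : ℂ × ℂ × ℂ → ℂ, ∀ᶠ q in 𝓝 p, DifferentiableAt ℂ g q ∧
      (q ∉ W → PhiS (mexp t) m s q.1 q.2.1 q.2.2 -
        SAct m (PhiS (mexp s) m t) q.1 q.2.1 q.2.2 = g q) := by
  have hnorm : ∀ x : ℝ, ‖mexp x‖ = 1 := fun x => by simp [norm_mexp]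
  have hp0 : p.1 ≠ 0 := fun h => by simp [h] at hp
  obtain ⟨g, hg⟩ := h
  obtain ⟨T₁, hT₁⟩ := exists_PhiS_eq_phiTerm_add (hnorm t) hm s n hp hn
  obtain ⟨T₂, hT₂⟩ := exists_PhiS_eq_phiTerm_add (hnorm s) hm t k (sMap_fst_im_pos hp) hk
  refine ⟨fun q => g q + T₁ q - sFactor m q * T₂ (sMap q), ?_⟩
  filter_upwards [hg, hT₁, (differentiableAt_sMap hp0).continuousAt.eventually hT₂,
    eventually_fst_im_pos hp] with q hg hT₁ hT₂ hq
  have hq0 : q.1 ≠ 0 := fun h => by simp [h] at hq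
  refine ⟨(hg.1.add hT₁.1).sub ((differentiableAt_sFactor m hq0).mul
    (hT₂.1.comp q (differentiableAt_sMap hq0))), fun hqW => ?_⟩
  have hS : SAct m (PhiS (mexp s) m t) q.1 q.2.1 q.2.2 =
      sFactor m q * PhiS (mexp s) m t (sMap q).1 (sMap q).2.1 (sMap q).2.2 := rfl
  rw [hS, hT₁.2, hT₂.2, ← hg.2 hqW]
  ring

theorem exists_PhiS_sub_SAct_eq_of_im_pos {m s t : ℝ} {M T : ℤ} (hm : 0 < m) (hM : 2 * m = M)
    (hT : 2 * t = T) {p : ℂ × ℂ × ℂ} (hp : 0 < p.1.im) :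
    ∃ g : ℂ × ℂ × ℂ → ℂ, ∀ᶠ q in 𝓝 p, DifferentiableAt ℂ g q ∧
      (q ∉ latticeDivisor → PhiS (mexp t) m s q.1 q.2.1 q.2.2 -
        SAct m (PhiS (mexp s) m t) q.1 q.2.1 q.2.2 = g q) := by
  have hp0 : p.1 ≠ 0 := fun h => by simp [h] at hp
  have hdual : ∀ l c : ℤ, (sMap p).2.1 + l * (sMap p).1 = c → p.2.1 = l + c * p.1 := by
    intro l c h
    simp only [sMap] at h
    field_simp at h
    linear_combination h
  by_cases hpZ : p ∈ latticeDivisor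
  · obtain ⟨a, b, hab⟩ := hpZ
    refine exists_PhiS_sub_SAct_eq (n := -b) (k := a) hm hp (fun l hl c h => hl ?_)
      (fun l hl c h => hl ?_) ?_
    · have := intCast_add_mul_inj (a := a) (b := b) (c := c) (d := -l) hp
        (by push_cast; linear_combination h - hab)
      omega
    · exact (intCast_add_mul_inj hp ((hdual l c h).symm.trans hab)).1
    · obtain ⟨g, hg⟩ := exists_phiTerm_sub_eq (s := s) hM hT (-b) a hp
        (by push_cast; linear_combination hab)
      refine ⟨g, hg.mono fun q hq => ⟨hq.1, fun hqZ => hq.2 fun h => hqZ ⟨a, b, ?_⟩⟩⟩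
      rw [h]
      push_cast
      ring
  · have hn : ∀ l c : ℤ, p.2.1 + l * p.1 ≠ c := fun l c h =>
      hpZ ⟨c, -l, by push_cast; linear_combination h⟩
    have hk : ∀ l c : ℤ, (sMap p).2.1 + l * (sMap p).1 ≠ c := fun l c h =>
      hpZ ⟨l, c, hdual l c h⟩
    refine exists_PhiS_sub_SAct_eq (n := 0) (k := 0) hm hp (fun l _ => hn l) (fun l _ => hk l)
      ⟨fun q => phiTerm (mexp t) m s 0 q - sFactor m q * phiTerm (mexp s) m t 0 (sMap q), ?_⟩
    filter_upwards [eventually_differentiableAt_phiTerm (mexp t) m s 0 (hn 0),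
      (differentiableAt_sMap hp0).continuousAt.eventually
        (eventually_differentiableAt_phiTerm (mexp s) m t 0 (hk 0)),
      eventually_fst_im_pos hp] with q h1 h2 hq
    have hq0 : q.1 ≠ 0 := fun h => by simp [h] at hq
    exact ⟨h1.sub ((differentiableAt_sFactor m hq0).mul
      (h2.comp q (differentiableAt_sMap hq0))), fun _ => rfl⟩

/-- The difference of `PhiS` and the `S`-transform of its dual is holomorphic on `Im τ > 0`. -/
theorem exists_differentiableOn_PhiS_sub_SAct {m s t : ℝ} {M T : ℤ} {ε ε' : ℂ} (hm : 0 < m)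
    (hM : 2 * m = M) (hT : 2 * t = T) (hε : mexp t = ε) (hε' : mexp s = ε') :
    ∃ G : ℂ × ℂ × ℂ → ℂ, DifferentiableOn ℂ G {p : ℂ × ℂ × ℂ | 0 < p.1.im} ∧
      ∀ τ z₁ z₂ : ℂ, 0 < τ.im → (∀ a b : ℤ, z₁ ≠ (a : ℂ) + (b : ℂ) * τ) →
        G (τ, z₁, z₂) = PhiS ε m s τ z₁ z₂ - SAct m (PhiS ε' m t) τ z₁ z₂ := by
  subst hε hε'
  obtain ⟨G, hG, hG'⟩ := exists_differentiableOn_extension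
    (U := {p : ℂ × ℂ × ℂ | 0 < p.1.im}) (Z := latticeDivisor)
    (fun q => PhiS (mexp t) m s q.1 q.2.1 q.2.2 - SAct m (PhiS (mexp s) m t) q.1 q.2.1 q.2.2)
    (fun p _ => dense_compl_latticeDivisor p)
    (isOpen_lt continuous_const (Complex.continuous_im.comp continuous_fst))
    (fun p hp => exists_PhiS_sub_SAct_eq_of_im_pos hm hM hT hp)
  exact ⟨G, hG, fun τ z₁ z₂ hτ hz => hG' (τ, z₁, z₂) hτ fun ⟨a, b, h⟩ => hz a b h⟩

end Extension

/-- each of the four differences `Φ^{+[m;s]} - Φ^{+[m;s₁]}|_S`,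
`Φ^{-[m;s]} - Φ^{+[m;s'+1/2]}|_S`, `Φ^{+[m;s'+1/2]} - Φ^{-[m;s]}|_S`,
`Φ^{-[m;s'+1/2]} - Φ^{-[m;s₁'+1/2]}|_S` extends to a holomorphic function on
`X₀ = {(τ,z₁,z₂) : Im τ > 0}`; here `m = m2/2 ∈ (1/2)ℤ_{>0}`, `s, s₁ ∈ ℤ`,
and `s' + 1/2, s₁' + 1/2 ∈ 1/2 + ℤ`. -/
theorem stmt11 (m2 : ℤ) (hm2 : 0 < m2) (s s₁ s' s₁' : ℤ) :
    (∃ G : ℂ × ℂ × ℂ → ℂ, DifferentiableOn ℂ G {p : ℂ × ℂ × ℂ | 0 < p.1.im} ∧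
      ∀ τ z₁ z₂ : ℂ, 0 < τ.im → (∀ a b : ℤ, z₁ ≠ (a : ℂ) + (b : ℂ) * τ) →
        G (τ, z₁, z₂) = PhiS 1 ((m2 : ℝ) / 2) (s : ℝ) τ z₁ z₂ -
          SAct ((m2 : ℝ) / 2) (PhiS 1 ((m2 : ℝ) / 2) (s₁ : ℝ)) τ z₁ z₂) ∧
    (∃ G : ℂ × ℂ × ℂ → ℂ, DifferentiableOn ℂ G {p : ℂ × ℂ × ℂ | 0 < p.1.im} ∧
      ∀ τ z₁ z₂ : ℂ, 0 < τ.im → (∀ a b : ℤ, z₁ ≠ (a : ℂ) + (b : ℂ) * τ) →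
        G (τ, z₁, z₂) = PhiS (-1) ((m2 : ℝ) / 2) (s : ℝ) τ z₁ z₂ -
          SAct ((m2 : ℝ) / 2) (PhiS 1 ((m2 : ℝ) / 2) ((s' : ℝ) + 1 / 2)) τ z₁ z₂) ∧
    (∃ G : ℂ × ℂ × ℂ → ℂ, DifferentiableOn ℂ G {p : ℂ × ℂ × ℂ | 0 < p.1.im} ∧
      ∀ τ z₁ z₂ : ℂ, 0 < τ.im → (∀ a b : ℤ, z₁ ≠ (a : ℂ) + (b : ℂ) * τ) →
        G (τ, z₁, z₂) = PhiS 1 ((m2 : ℝ) / 2) ((s' : ℝ) + 1 / 2) τ z₁ z₂ -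
          SAct ((m2 : ℝ) / 2) (PhiS (-1) ((m2 : ℝ) / 2) (s : ℝ)) τ z₁ z₂) ∧
    (∃ G : ℂ × ℂ × ℂ → ℂ, DifferentiableOn ℂ G {p : ℂ × ℂ × ℂ | 0 < p.1.im} ∧
      ∀ τ z₁ z₂ : ℂ, 0 < τ.im → (∀ a b : ℤ, z₁ ≠ (a : ℂ) + (b : ℂ) * τ) →
        G (τ, z₁, z₂) = PhiS (-1) ((m2 : ℝ) / 2) ((s' : ℝ) + 1 / 2) τ z₁ z₂ -
          SAct ((m2 : ℝ) / 2) (PhiS (-1) ((m2 : ℝ) / 2) ((s₁' : ℝ) + 1 / 2)) τ z₁ z₂) := by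
  have hm : (0 : ℝ) < (m2 : ℝ) / 2 := by positivity
  have hM : 2 * ((m2 : ℝ) / 2) = m2 := by ring
  have hint : ∀ n : ℤ, mexp ((n : ℝ) : ℂ) = 1 := fun n => by
    simpa using mexp_intCast n
  have hhalf : ∀ n : ℤ, mexp (((n : ℝ) + 1 / 2 : ℝ) : ℂ) = -1 := fun n => by
    simpa using mexp_intCast_add_half n
  have hT : ∀ n : ℤ, 2 * (n : ℝ) = (2 * n : ℤ) := fun n => by push_cast; ring
  have hT' : ∀ n : ℤ, 2 * ((n : ℝ) + 1 / 2) = (2 * n + 1 : ℤ) := fun n => by push_cast; ring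
  exact ⟨exists_differentiableOn_PhiS_sub_SAct hm hM (hT s₁) (hint s₁) (hint s),
    exists_differentiableOn_PhiS_sub_SAct hm hM (hT' s') (hhalf s') (hint s),
    exists_differentiableOn_PhiS_sub_SAct hm hM (hT s) (hint s) (hhalf s'),
    exists_differentiableOn_PhiS_sub_SAct hm hM (hT' s₁') (hhalf s₁') (hhalf s')⟩
end

section
/- Let m ∈ (1/2)ℤ_{>0}, j ∈ ℤ, and s₁ ∈ ℤ, and define a_j^{++[s₁]}(τ, v) = −R^{+}_{j,m}(τ, v) − (i/√(2m)) (−iτ)^{−1/2} e^{2πi m v²/τ} Σ_{k ∈ ℤ, s₁ ≤ k < s₁ + 2m} e^{−πi j k/m} R^{+}_{k,m}(−1/τ, v/τ), where (−iτ)^{−1/2} is the principal branch (note Re(−iτ) > 0 when Im τ > 0). Then, although each R^{+} is only real analytic, for every fixed τ with Im τ > 0 the function v ↦ a_j^{++[s₁]}(τ, v) is holomorphic on all of ℂ. -/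
namespace RSHolomorphy

open Complex ComplexConjugate MeasureTheory Set

lemma hasDerivAt_Efun (x : ℝ) : HasDerivAt Efun (2 * Real.exp (-Real.pi * x ^ 2)) x := by
  have hc : Continuous fun u : ℝ => Real.exp (-Real.pi * u ^ 2) := by fun_prop
  exact (intervalIntegral.integral_hasDerivAt_right (hc.intervalIntegrable _ _)
    (hc.stronglyMeasurableAtFilter _ _) hc.continuousAt).const_mul 2

lemma Efun_neg (x : ℝ) : Efun (-x) = -Efun x := by
  have h := intervalIntegral.integral_comp_neg (a := 0) (b := x)
    fun u : ℝ => Real.exp (-Real.pi * u ^ 2)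
  simp only [even_two.neg_pow, neg_zero] at h
  rw [Efun, Efun, h, intervalIntegral.integral_symm (-x) 0]
  ring

lemma integrable_gaussian : Integrable fun u : ℝ => Real.exp (-Real.pi * u ^ 2) :=
  integrable_exp_neg_mul_sq Real.pi_pos

lemma integral_gaussian_half_line :
    ∫ u in Ioi (0 : ℝ), Real.exp (-Real.pi * u ^ 2) = 1 / 2 := by
  rw [integral_gaussian_Ioi, div_self Real.pi_ne_zero, Real.sqrt_one]

lemma one_sub_Efun (x : ℝ) :
    1 - Efun x = 2 * ∫ u in Ioi x, Real.exp (-Real.pi * u ^ 2) := by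
  have h := intervalIntegral.integral_Ioi_sub_Ioi'
    (integrable_gaussian.integrableOn (s := Ioi 0)) (integrable_gaussian.integrableOn (s := Ioi x))
  rw [Efun, ← h, integral_gaussian_half_line]
  ring

lemma Efun_le_one (x : ℝ) : Efun x ≤ 1 := by
  have : 0 ≤ ∫ u in Ioi x, Real.exp (-Real.pi * u ^ 2) :=
    integral_nonneg fun _ => (Real.exp_pos _).le
  linarith [one_sub_Efun x]

lemma neg_one_le_Efun (x : ℝ) : -1 ≤ Efun x := by
  linarith [Efun_le_one (-x), Efun_neg x]

lemma one_sub_Efun_le {x : ℝ} (hx : 0 ≤ x) : 1 - Efun x ≤ Real.exp (-Real.pi * x ^ 2) := by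
  have hs : ∫ u in Ioi x, Real.exp (-Real.pi * u ^ 2) =
      ∫ u in Ioi (0 : ℝ), Real.exp (-Real.pi * (u + x) ^ 2) := by
    have h := (measurePreserving_add_right volume x).setIntegral_preimage_emb
      (measurableEmbedding_addRight x) (fun u : ℝ => Real.exp (-Real.pi * u ^ 2)) (Ioi x)
    rwa [preimage_add_const_Ioi, sub_self, eq_comm] at h
  have hle : ∫ u in Ioi (0 : ℝ), Real.exp (-Real.pi * (u + x) ^ 2) ≤
      ∫ u in Ioi (0 : ℝ), Real.exp (-Real.pi * x ^ 2) * Real.exp (-Real.pi * u ^ 2) := by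
    refine setIntegral_mono_on (integrable_gaussian.comp_add_right x).integrableOn
      (integrable_gaussian.const_mul _).integrableOn measurableSet_Ioi fun u hu => ?_
    rw [← Real.exp_add, Real.exp_le_exp]
    have : 0 ≤ Real.pi * (u * x) := mul_nonneg Real.pi_pos.le (mul_nonneg (le_of_lt hu) hx)
    nlinarith
  rw [integral_const_mul, integral_gaussian_half_line] at hle
  rw [one_sub_Efun, hs]
  linarith

lemma abs_one_sub_Efun_le {D x : ℝ} (hD : 0 ≤ D) (hx : -D ≤ x) :
    |1 - Efun x| ≤ 2 * Real.exp (Real.pi * D ^ 2) * Real.exp (-Real.pi * x ^ 2) := by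
  rw [abs_of_nonneg (by linarith [Efun_le_one x]), mul_assoc, ← Real.exp_add]
  rcases le_total 0 x with h | h
  · have h1 := one_sub_Efun_le h
    have h2 : Real.exp (-Real.pi * x ^ 2) ≤
        Real.exp (Real.pi * D ^ 2 + -Real.pi * x ^ 2) :=
      Real.exp_le_exp.2 (by nlinarith [Real.pi_pos, mul_nonneg Real.pi_pos.le (sq_nonneg D)])
    linarith [Real.exp_pos (-Real.pi * x ^ 2)]
  · have h2 : x ^ 2 ≤ D ^ 2 := by nlinarith
    have h3 := Real.one_le_exp (x := Real.pi * D ^ 2 + -Real.pi * x ^ 2)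
      (by nlinarith [Real.pi_pos])
    linarith [neg_one_le_Efun x]

lemma abs_neg_one_sub_Efun_le {D x : ℝ} (hD : 0 ≤ D) (hx : x ≤ D) :
    |-1 - Efun x| ≤ 2 * Real.exp (Real.pi * D ^ 2) * Real.exp (-Real.pi * x ^ 2) := by
  have h := abs_one_sub_Efun_le hD (neg_le_neg hx)
  rwa [Efun_neg, neg_sq, ← abs_neg, show -(1 - -Efun x) = -1 - Efun x by ring] at h

/-- `f` is real differentiable at `z`, with `∂f/∂z̄ = b` there. -/
def HasDbarAt (f : ℂ → ℂ) (b z : ℂ) : Prop :=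
  ∃ a : ℂ, HasFDerivAt f
    (a • ContinuousLinearMap.id ℝ ℂ + b • (conjCLE : ℂ →L[ℝ] ℂ)) z

lemma HasDbarAt.differentiableAt {f : ℂ → ℂ} {z : ℂ} (h : HasDbarAt f 0 z) :
    DifferentiableAt ℂ f z := by
  obtain ⟨a, h⟩ := h
  refine differentiableAt_complex_iff_differentiableAt_real.2 ⟨h.differentiableAt, ?_⟩
  rw [h.fderiv]
  simp [mul_comm]

lemma HasDbarAt.neg {f : ℂ → ℂ} {b z : ℂ} (hf : HasDbarAt f b z) :
    HasDbarAt (fun w => -f w) (-b) z := by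
  obtain ⟨a, h⟩ := hf
  refine ⟨-a, h.neg.congr_fderiv ?_⟩
  module

lemma HasDbarAt.sub {f g : ℂ → ℂ} {b c z : ℂ} (hf : HasDbarAt f b z) (hg : HasDbarAt g c z) :
    HasDbarAt (fun w => f w - g w) (b - c) z := by
  obtain ⟨a, h⟩ := hf
  obtain ⟨a', h'⟩ := hg
  exact ⟨a - a', (h.sub h').congr_fderiv (by module)⟩

lemma HasDbarAt.sum {ι : Type*} {s : Finset ι} {f : ι → ℂ → ℂ} {b : ι → ℂ} {z : ℂ}
    (h : ∀ i ∈ s, HasDbarAt (f i) (b i) z) :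
    HasDbarAt (fun w => ∑ i ∈ s, f i w) (∑ i ∈ s, b i) z := by
  choose! a ha using h
  refine ⟨∑ i ∈ s, a i, (HasFDerivAt.fun_sum ha).congr_fderiv ?_⟩
  ext
  simp [Finset.sum_add_distrib, Finset.sum_mul]

lemma HasDbarAt.mul_left {f g : ℂ → ℂ} {b z : ℂ} (hf : HasDbarAt f b z)
    (hg : DifferentiableAt ℂ g z) : HasDbarAt (fun w => g w * f w) (g z * b) z := by
  obtain ⟨a, h⟩ := hf
  have hg' := hg.hasDerivAt.hasFDerivAt.restrictScalars ℝ
  refine ⟨g z * a + f z * deriv g z, (hg'.mul h).congr_fderiv ?_⟩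
  ext x
  simp
  ring

lemma HasDbarAt.comp {f g : ℂ → ℂ} {b g' z : ℂ} (hf : HasDbarAt f b (g z))
    (hg : HasDerivAt g g' z) : HasDbarAt (fun w => f (g w)) (b * conj g') z := by
  obtain ⟨a, h⟩ := hf
  have hg' := hg.hasFDerivAt.restrictScalars ℝ
  refine ⟨a * g', (h.comp z hg').congr_fderiv ?_⟩
  ext x
  simp
  ring

lemma conj_eq_sub (w : ℂ) : conj w = w - 2 * w.im * I := by
  apply Complex.ext <;> simp
  ring

lemma hasFDerivAt_psiMN (m n : ℝ) (τ z : ℂ) :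
    HasFDerivAt (psiMN m n τ) (-(2 * m / τ.im * √(τ.im / m)) • imCLM) z := by
  have h := (((imCLM.hasFDerivAt (x := z)).const_mul (2 * m / τ.im)).const_sub n).mul_const
    (√(τ.im / m))
  refine (h.congr_fderiv ?_).congr_of_eventuallyEq (.of_forall fun w => ?_)
  · module
  · simp only [psiMN, imCLM_apply]
    ring

/-- The exponential factor in the `n`-th term of `RS`. -/
noncomputable def expFactor (m n : ℝ) (τ z : ℂ) : ℂ :=
  Complex.exp (-(Real.pi : ℂ) * Complex.I * (n : ℂ) ^ 2 * τ / (2 * (m : ℂ))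
      + 2 * (Real.pi : ℂ) * Complex.I * (n : ℂ) * z)

lemma hasDerivAt_expFactor (m n : ℝ) (τ z : ℂ) :
    HasDerivAt (expFactor m n τ) (2 * Real.pi * I * n * expFactor m n τ z) z := by
  have h := (((hasDerivAt_id z).const_mul (2 * Real.pi * I * n)).const_add
    (-Real.pi * I * n ^ 2 * τ / (2 * m))).cexp
  rw [mul_one] at h
  exact h.congr_deriv (mul_comm _ _)

lemma gaussian_mul_expFactor {M : ℕ} (hM : 0 < M) (n : ℤ) {τ : ℂ} (hτ : 0 < τ.im) (z : ℂ) :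
    (Real.exp (-Real.pi * psiMN (M / 2) n τ z ^ 2) : ℂ) * expFactor (M / 2) n τ z =
      Real.exp (-2 * Real.pi * M * z.im ^ 2 / τ.im) *
        jacobiTheta₂_term n (conj z) (-conj τ / M) := by
  have hM' : (0 : ℝ) < M := Nat.cast_pos.2 hM
  have hψ : psiMN (M / 2) n τ z ^ 2 =
      2 * n ^ 2 * τ.im / M - 4 * n * z.im + 2 * M * z.im ^ 2 / τ.im := by
    rw [psiMN, mul_pow, Real.sq_sqrt (by positivity)]
    field_simp
    ring
  rw [hψ, expFactor, jacobiTheta₂_term, ofReal_exp, ofReal_exp, ← Complex.exp_add,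
    ← Complex.exp_add, conj_eq_sub z, conj_eq_sub τ]
  congr 1
  push_cast
  linear_combination (4 * Real.pi * n * z.im - 2 * Real.pi * n ^ 2 * τ.im / M) * I_sq

lemma norm_gaussian_mul_expFactor_le {M : ℕ} (hM : 0 < M) (n : ℤ) {τ : ℂ} (hτ : 0 < τ.im)
    {z : ℂ} {B : ℝ} (hz : |z.im| ≤ B) :
    Real.exp (-Real.pi * psiMN (M / 2) n τ z ^ 2) * ‖expFactor (M / 2) n τ z‖ ≤
      Real.exp (-Real.pi * (τ.im / M * n ^ 2 - 2 * B * |n|)) := by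
  have hM' : (0 : ℝ) < M := Nat.cast_pos.2 hM
  have h := congrArg norm (gaussian_mul_expFactor hM n hτ z)
  rw [norm_mul, norm_mul, norm_real, norm_real, Real.norm_of_nonneg (Real.exp_pos _).le,
    Real.norm_of_nonneg (Real.exp_pos _).le] at h
  rw [h]
  have hT : τ.im / M ≤ (-conj τ / M : ℂ).im := by
    rw [div_natCast_im, neg_im, conj_im, neg_neg]
  have h1 := norm_jacobiTheta₂_term_le (z := conj z) (by positivity) (by simpa using hz) hT n
  have h2 : Real.exp (-2 * Real.pi * M * z.im ^ 2 / τ.im) ≤ 1 := by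
    rw [Real.exp_le_one_iff, neg_mul, neg_mul, neg_mul, neg_div, neg_nonpos]
    have := Real.pi_pos
    positivity
  simpa using mul_le_mul h2 h1 (norm_nonneg _) zero_le_one

/-- The `n`-th term of `RS`, with sign `σ`. -/
noncomputable def rsTerm (σ m n : ℝ) (τ z : ℂ) : ℂ :=
  ((σ - Efun (psiMN m n τ z) : ℝ) : ℂ) * expFactor m n τ z

lemma hasFDerivAt_rsTerm (σ m n : ℝ) (τ z : ℂ) :
    HasFDerivAt (rsTerm σ m n τ)
      ((2 * Real.pi * I * n * rsTerm σ m n τ z -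
          I * ↑(2 * m / τ.im * √(τ.im / m)) *
            (Real.exp (-Real.pi * psiMN m n τ z ^ 2) * expFactor m n τ z)) •
          ContinuousLinearMap.id ℝ ℂ +
        (I * ↑(2 * m / τ.im * √(τ.im / m)) *
            (Real.exp (-Real.pi * psiMN m n τ z ^ 2) * expFactor m n τ z)) •
          (conjCLE : ℂ →L[ℝ] ℂ)) z := by
  have h1 := ((hasDerivAt_Efun (psiMN m n τ z)).comp_hasFDerivAt z
    (hasFDerivAt_psiMN m n τ z)).const_sub σ
  have h2 := (ofRealCLM.hasFDerivAt.comp z h1).mul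
    ((hasDerivAt_expFactor m n τ z).hasFDerivAt.restrictScalars ℝ)
  refine h2.congr_fderiv ?_
  ext x
  simp [rsTerm, conj_eq_sub x]
  linear_combination (4 * expFactor m n τ z * cexp (-(Real.pi * psiMN m n τ z ^ 2)) * m / τ.im *
    √(τ.im / m) * x.im) * I_sq

lemma norm_rsTerm_le {σ m n τ z} {D : ℝ} (hD : 0 ≤ D)
    (h : (σ = 1 ∧ -D ≤ psiMN m n τ z) ∨ (σ = -1 ∧ psiMN m n τ z ≤ D)) :
    ‖rsTerm σ m n τ z‖ ≤ 2 * Real.exp (Real.pi * D ^ 2) *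
      (Real.exp (-Real.pi * psiMN m n τ z ^ 2) * ‖expFactor m n τ z‖) := by
  rw [rsTerm, norm_mul, ← mul_assoc, norm_real, Real.norm_eq_abs]
  refine mul_le_mul_of_nonneg_right ?_ (norm_nonneg _)
  obtain ⟨rfl, h⟩ | ⟨rfl, h⟩ := h
  · exact abs_one_sub_Efun_le hD h
  · exact abs_neg_one_sub_Efun_le hD h

/-- The theta series over the residue class of `j` modulo `M`. -/
noncomputable def thetaResidue (M : ℕ) (j : ℤ) (τ ζ : ℂ) : ℂ :=
  ∑' k : ℤ, jacobiTheta₂_term (j + M * k) ζ (τ / M)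

lemma sign_eq_one_or_neg_one {M : ℕ} (hM : 0 < M) (j k : ℤ) :
    (Real.sign (j + 2 * (M / 2) * k - 1 / 2 - j + 2 * (M / 2)) = 1 ∧ 0 ≤ k) ∨
      (Real.sign (j + 2 * (M / 2) * k - 1 / 2 - j + 2 * (M / 2)) = -1 ∧ k ≤ 0) := by
  have hM' : (1 : ℝ) ≤ M := Nat.one_le_cast.2 hM
  rcases le_or_gt 0 k with hk | hk
  · have hk' : (0 : ℝ) ≤ k := Int.cast_nonneg hk
    exact .inl ⟨Real.sign_of_pos (by nlinarith), hk⟩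
  · have hk' : (k : ℝ) ≤ -1 := by exact_mod_cast Int.le_sub_one_of_lt hk
    exact .inr ⟨Real.sign_of_neg (by nlinarith), hk.le⟩

lemma RS_eq_tsum_rsTerm (M : ℕ) (j : ℤ) (τ z : ℂ) :
    RS 1 j (M / 2) τ z = ∑' k : ℤ,
      rsTerm (Real.sign (j + 2 * (M / 2) * k - 1 / 2 - j + 2 * (M / 2))) (M / 2)
        ((j + M * k : ℤ) : ℝ) τ z := by
  refine tsum_congr fun k => ?_
  have h : ((j + M * k : ℤ) : ℝ) = j + 2 * (M / 2) * k := by push_cast; ring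
  rw [one_zpow, one_mul, rsTerm, expFactor, h]

lemma neg_le_psiMN_or_psiMN_le {M : ℕ} (hM : 0 < M) {τ z : ℂ} (hτ : 0 < τ.im) {B : ℝ}
    (hz : |z.im| ≤ B) (j k : ℤ) :
    (0 ≤ k → -(√(τ.im / (M / 2)) * (|j| + M * B / τ.im)) ≤
        psiMN (M / 2) ((j + M * k : ℤ) : ℝ) τ z) ∧
      (k ≤ 0 → psiMN (M / 2) ((j + M * k : ℤ) : ℝ) τ z ≤
        √(τ.im / (M / 2)) * (|j| + M * B / τ.im)) := by
  have hM' : (0 : ℝ) < M := Nat.cast_pos.2 hM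
  have hs := Real.sqrt_nonneg (τ.im / (M / 2))
  have hq : 2 * (M / 2) * z.im / τ.im ≤ M * B / τ.im ∧
      -(M * B / τ.im) ≤ 2 * (M / 2) * z.im / τ.im := by
    rw [← neg_div, div_le_div_iff_of_pos_right hτ, div_le_div_iff_of_pos_right hτ]
    constructor <;> nlinarith [abs_le.1 hz]
  have hj : -(|j| : ℝ) ≤ j ∧ (j : ℝ) ≤ |j| := by
    exact_mod_cast abs_le.1 (le_refl |j|)
  constructor <;> intro hk
  · have hk' : (0 : ℝ) ≤ M * k := mul_nonneg hM'.le (Int.cast_nonneg hk)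
    rw [psiMN, ← mul_neg, mul_comm]
    refine mul_le_mul_of_nonneg_right ?_ hs
    push_cast at hj ⊢
    linarith
  · have hk' : M * (k : ℝ) ≤ 0 := mul_nonpos_of_nonneg_of_nonpos hM'.le (Int.cast_nonpos.2 hk)
    rw [psiMN, mul_comm]
    refine mul_le_mul_of_nonneg_left ?_ hs
    push_cast at hj ⊢
    linarith

lemma hasDbarAt_RS {M : ℕ} (hM : 0 < M) (j : ℤ) {τ : ℂ} (hτ : 0 < τ.im) (z : ℂ) :
    HasDbarAt (RS 1 j (M / 2) τ)
      (I * ↑(M / τ.im * √(τ.im / (M / 2))) *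
        (Real.exp (-2 * Real.pi * M * z.im ^ 2 / τ.im) *
          thetaResidue M j (-conj τ) (conj z))) z := by
  have hM' : (0 : ℝ) < M := Nat.cast_pos.2 hM
  set B := |z.im| + 1 with hB
  set D := √(τ.im / (M / 2)) * (|j| + M * B / τ.im) with hD
  have hD0 : 0 ≤ D := by positivity
  set K := 2 * Real.exp (Real.pi * D ^ 2) with hK
  set C := M / τ.im * √(τ.im / (M / 2)) with hC
  have hC0 : 0 ≤ C := by positivity
  have hCC : 2 * (M / 2 : ℝ) / τ.im * √(τ.im / (M / 2)) = C := by rw [hC]; ring_nf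
  let N (k : ℤ) : ℤ := j + M * k
  have hN : Function.Injective N := fun a b h => by
    simpa [N, hM.ne'] using h
  let w (n : ℤ) : ℝ := Real.exp (-Real.pi * (τ.im / M * n ^ 2 - 2 * B * |n|))
  have hw0 : Summable fun k => w (N k) := by
    simpa [w, Function.comp_def] using
      (summable_pow_mul_jacobiTheta₂_term_bound B (div_pos hτ hM') 0).comp_injective hN
  have hw1 : Summable fun k => |(N k : ℝ)| * w (N k) := by
    simpa [w, Function.comp_def] using
      (summable_pow_mul_jacobiTheta₂_term_bound B (div_pos hτ hM') 1).comp_injective hN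
  let σ (k : ℤ) : ℝ := Real.sign (j + 2 * (M / 2) * k - 1 / 2 - j + 2 * (M / 2))
  let f (k : ℤ) (x : ℂ) : ℂ := rsTerm (σ k) (M / 2) (N k) τ x
  let g (k : ℤ) (x : ℂ) : ℂ :=
    Real.exp (-Real.pi * psiMN (M / 2) (N k) τ x ^ 2) * expFactor (M / 2) (N k) τ x
  let b (k : ℤ) (x : ℂ) : ℂ := I * C * g k x
  let a (k : ℤ) (x : ℂ) : ℂ := 2 * Real.pi * I * N k * f k x - b k x
  have hx {x : ℂ} (h : x ∈ Metric.ball z 1) : |x.im| ≤ B := by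
    have h1 := (abs_im_le_norm (x - z)).trans (mem_ball_iff_norm.1 h).le
    have h2 := abs_sub_abs_le_abs_sub x.im z.im
    rw [sub_im] at h1
    linarith
  have hg (k : ℤ) {x : ℂ} (h : x ∈ Metric.ball z 1) : ‖g k x‖ ≤ w (N k) := by
    rw [norm_mul, norm_real, Real.norm_of_nonneg (Real.exp_pos _).le]
    exact norm_gaussian_mul_expFactor_le hM (N k) hτ (hx h)
  have hf (k : ℤ) {x : ℂ} (h : x ∈ Metric.ball z 1) : ‖f k x‖ ≤ K * w (N k) := by
    have hψ := neg_le_psiMN_or_psiMN_le hM hτ (hx h) j k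
    refine (norm_rsTerm_le hD0 ((sign_eq_one_or_neg_one hM j k).imp
      (And.imp_right hψ.1) (And.imp_right hψ.2))).trans ?_
    exact mul_le_mul_of_nonneg_left
      (norm_gaussian_mul_expFactor_le hM (N k) hτ (hx h)) (by positivity)
  have hb (k : ℤ) {x : ℂ} (h : x ∈ Metric.ball z 1) : ‖b k x‖ ≤ C * w (N k) := by
    rw [norm_mul, norm_mul, norm_I, one_mul, norm_real, Real.norm_of_nonneg hC0]
    exact mul_le_mul_of_nonneg_left (hg k h) hC0
  have ha (k : ℤ) {x : ℂ} (h : x ∈ Metric.ball z 1) :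
      ‖a k x‖ ≤ 2 * Real.pi * K * (|(N k : ℝ)| * w (N k)) + C * w (N k) := by
    refine (norm_sub_le _ _).trans (add_le_add ?_ (hb k h))
    rw [norm_mul, norm_mul, norm_mul, norm_mul, norm_I, norm_real, Complex.norm_intCast,
      Real.norm_of_nonneg Real.pi_pos.le, Complex.norm_ofNat, mul_one]
    refine (mul_le_mul_of_nonneg_left (hf k h) (by positivity)).trans_eq (by ring)
  have hz : z ∈ Metric.ball z 1 := Metric.mem_ball_self one_pos
  have hua : Summable fun k => 2 * Real.pi * K * (|(N k : ℝ)| * w (N k)) + C * w (N k) :=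
    (hw1.mul_left _).add (hw0.mul_left _)
  have hub : Summable fun k => C * w (N k) := hw0.mul_left _
  have hderiv := hasFDerivAt_tsum_of_isPreconnected (𝕜 := ℝ) (f := f)
    (f' := fun k x => a k x • ContinuousLinearMap.id ℝ ℂ + b k x • (conjCLE : ℂ →L[ℝ] ℂ))
    (hua.add hub) Metric.isOpen_ball (convex_ball z 1).isPreconnected
    (fun k x _ => by
      have h := hasFDerivAt_rsTerm (σ k) (M / 2) (N k) τ x
      rw [hCC] at h
      simpa only [f, a, b, g, ofReal_intCast] using h)
    (fun k x h => by
      refine (norm_add_le _ _).trans (add_le_add ?_ ?_)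
      · rw [norm_smul, ContinuousLinearMap.norm_id, mul_one]
        exact ha k h
      · rw [norm_smul, conjCLE_norm, mul_one]
        exact hb k h)
    hz ((hw0.mul_left K).of_norm_bounded fun k => hf k hz) hz
  have hRS : RS 1 j (M / 2) τ = fun x => ∑' k, f k x := funext fun x => RS_eq_tsum_rsTerm M j τ x
  have hsa : Summable fun k => a k z := hua.of_norm_bounded fun k => ha k hz
  have hsb : Summable fun k => b k z := hub.of_norm_bounded fun k => hb k hz
  rw [hRS]
  refine ⟨∑' k, a k z, hderiv.congr_fderiv ?_⟩
  rw [((hsa.hasSum.smul_const _).add (hsb.hasSum.smul_const _)).tsum_eq]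
  congr 2
  rw [thetaResidue, ← tsum_mul_left, ← tsum_mul_left]
  refine tsum_congr fun k => ?_
  simp only [b, g]
  rw [gaussian_mul_expFactor hM (N k) hτ z]

lemma sum_range_tsum_residue {M : ℕ} (hM : 0 < M) (s : ℤ) {F : ℤ → ℂ} (hF : Summable F) :
    ∑ i ∈ Finset.range M, ∑' k : ℤ, F (s + i + M * k) = ∑' n, F n := by
  have : NeZero M := ⟨hM.ne'⟩
  let e : Fin M × ℤ ≃ ℤ :=
    ((Equiv.prodComm _ _).trans (Int.divModEquiv M).symm).trans (Equiv.addLeft s)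
  have he (p : Fin M × ℤ) : e p = s + (p.1 : ℕ) + M * p.2 := by
    simp only [e, Equiv.trans_apply, Equiv.prodComm_apply, Int.divModEquiv_symm_apply,
      Equiv.coe_addLeft, Prod.fst_swap, Prod.snd_swap]
    ring
  have h := (e.summable_iff.2 hF).tsum_prod
  simp only [Function.comp_apply] at h
  rw [← e.tsum_eq F, h, tsum_fintype,
    ← Fin.sum_univ_eq_sum_range (fun i => ∑' k : ℤ, F (s + i + M * k))]
  simp only [he]

lemma exp_mul_jacobiTheta₂_term {M : ℕ} (hM : 0 < M) (j n k : ℤ) (τ ζ : ℂ) :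
    Complex.exp (-(Real.pi : ℂ) * Complex.I * j * n / (M / 2)) *
        jacobiTheta₂_term (n + M * k) ζ τ =
      jacobiTheta₂_term (n + M * k) (ζ - j / M) τ := by
  have hMc : (M : ℂ) ≠ 0 := Nat.cast_ne_zero.2 hM.ne'
  rw [jacobiTheta₂_term, jacobiTheta₂_term, ← Complex.exp_add, Complex.exp_eq_exp_iff_exists_int]
  refine ⟨j * k, ?_⟩
  push_cast
  field_simp
  ring

lemma sum_exp_mul_thetaResidue {M : ℕ} (hM : 0 < M) (j s : ℤ) {τ : ℂ} (hτ : 0 < τ.im) (ζ : ℂ) :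
    ∑ i ∈ Finset.range M, Complex.exp (-(Real.pi : ℂ) * Complex.I * j * (s + i) / (M / 2)) *
        thetaResidue M (s + i) τ ζ =
      jacobiTheta₂ (ζ - j / M) (τ / M) := by
  have hτM : 0 < (τ / M).im := by
    rw [div_natCast_im]
    exact div_pos hτ (Nat.cast_pos.2 hM)
  rw [jacobiTheta₂, ← sum_range_tsum_residue hM s
    ((summable_jacobiTheta₂_term_iff (ζ - j / M) (τ / M)).2 hτM)]
  refine Finset.sum_congr rfl fun i _ => ?_
  rw [thetaResidue, ← tsum_mul_left]
  refine tsum_congr fun k => ?_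
  rw [← exp_mul_jacobiTheta₂_term hM]
  push_cast
  rfl

lemma thetaResidue_eq_jacobiTheta₂ {M : ℕ} (hM : 0 < M) (j : ℤ) (τ ζ : ℂ) :
    thetaResidue M j τ ζ =
      Complex.exp (Real.pi * I * j ^ 2 * τ / M + 2 * Real.pi * I * j * ζ) *
        jacobiTheta₂ (M * ζ + j * τ) (M * τ) := by
  have hMc : (M : ℂ) ≠ 0 := Nat.cast_ne_zero.2 hM.ne'
  rw [thetaResidue, jacobiTheta₂, ← tsum_mul_left]
  refine tsum_congr fun k => ?_
  rw [jacobiTheta₂_term, jacobiTheta₂_term, ← Complex.exp_add]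
  congr 1
  push_cast
  field_simp
  ring

lemma neg_one_div_im (τ : ℂ) : (-1 / τ).im = τ.im / normSq τ := by
  rw [neg_div, neg_im, one_div, inv_im, neg_div, neg_neg]

lemma thetaResidue_functional_equation {M : ℕ} (hM : 0 < M) (j s : ℤ) {τ : ℂ} (hτ : 0 < τ.im)
    (ζ : ℂ) :
    thetaResidue M j τ ζ =
      (√(M : ℝ) : ℂ)⁻¹ * (-I * τ) ^ (-(1 / 2 : ℂ)) * Complex.exp (-Real.pi * I * M * ζ ^ 2 / τ) *
        ∑ i ∈ Finset.range M, Complex.exp (-(Real.pi : ℂ) * Complex.I * j * (s + i) / (M / 2)) *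
          thetaResidue M (s + i) (-1 / τ) (-ζ / τ) := by
  have hτ0 : τ ≠ 0 := fun h => by simp [h] at hτ
  have hMc : (M : ℂ) ≠ 0 := Nat.cast_ne_zero.2 hM.ne'
  have hτ' : 0 < (-1 / τ).im := by
    rw [neg_one_div_im]
    exact div_pos hτ (normSq_pos.2 hτ0)
  have hsqrt : (-I * (M * τ)) ^ (1 / 2 : ℂ) = (√(M : ℝ) : ℂ) * (-I * τ) ^ (1 / 2 : ℂ) := by
    have hM' : (0 : ℝ) < M := Nat.cast_pos.2 hM
    have hw : -I * τ ≠ 0 := mul_ne_zero (neg_ne_zero.2 I_ne_zero) hτ0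
    rw [mul_left_comm, Real.sqrt_eq_rpow, ofReal_cpow hM'.le, ← ofReal_natCast,
      cpow_def_of_ne_zero (mul_ne_zero (ofReal_ne_zero.2 hM'.ne') hw), log_ofReal_mul hM' hw,
      add_mul, Complex.exp_add, ← cpow_def_of_ne_zero hw, ofReal_log hM'.le,
      ← cpow_def_of_ne_zero (ofReal_ne_zero.2 hM'.ne')]
    norm_num
  have hexp : Complex.exp (Real.pi * I * j ^ 2 * τ / M + 2 * Real.pi * I * j * ζ) *
      Complex.exp (-Real.pi * I * (M * ζ + j * τ) ^ 2 / (M * τ)) =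
      Complex.exp (-Real.pi * I * M * ζ ^ 2 / τ) := by
    rw [← Complex.exp_add]
    congr 1
    field_simp
    ring
  have hz : (M * ζ + j * τ) / (M * τ) = -(-ζ / τ - j / M) := by
    field_simp
    ring
  have ht : -1 / (M * τ) = -1 / τ / M := by
    field_simp
  rw [sum_exp_mul_thetaResidue hM j s hτ', thetaResidue_eq_jacobiTheta₂ hM,
    jacobiTheta₂_functional_equation, hsqrt, ← hexp, hz, ht, jacobiTheta₂_neg_left, cpow_neg]
  field_simp

lemma ofReal_im_sq_div_im (w τ : ℂ) :
    ((w.im ^ 2 / τ.im : ℝ) : ℂ) = -(I / 2) * (w - conj w) ^ 2 / (τ - conj τ) := by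
  rw [sub_conj, sub_conj]
  by_cases h : (τ.im : ℂ) = 0
  · simp [h]
  push_cast
  field_simp
  linear_combination (w.im : ℂ) ^ 2 * I_sq

lemma gaussian_mul_exp_conj {τ : ℂ} (hτ : 0 < τ.im) (M : ℕ) (v : ℂ) :
    (Real.exp (-2 * Real.pi * M * v.im ^ 2 / τ.im) : ℂ) *
        Complex.exp (-Real.pi * I * M * conj v ^ 2 / -conj τ) =
      Complex.exp (2 * Real.pi * I * (M / 2) * v ^ 2 / τ) *
        Real.exp (-2 * Real.pi * M * (v / τ).im ^ 2 / (-1 / τ).im) := by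
  have hτ0 : τ ≠ 0 := fun h => by simp [h] at hτ
  have hτ0' : conj τ ≠ 0 := (map_ne_zero _).2 hτ0
  have hsub : τ - conj τ ≠ 0 := by
    rw [sub_conj]
    simp [hτ.ne']
  rw [mul_div_assoc, mul_div_assoc _ ((v / τ).im ^ 2), ofReal_exp, ofReal_exp, ofReal_mul,
    ofReal_mul _ ((v / τ).im ^ 2 / (-1 / τ).im), ofReal_im_sq_div_im, ofReal_im_sq_div_im,
    ← Complex.exp_add, ← Complex.exp_add]
  have hd : -1 / τ - conj (-1 / τ) = (τ - conj τ) / (τ * conj τ) := by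
    simp only [map_div₀, map_neg, map_one]
    field_simp
    ring
  rw [hd, map_div₀]
  congr 1
  push_cast
  field_simp
  ring

lemma gaussian_coeff_neg_one_div {τ : ℂ} (hτ : 0 < τ.im) (M : ℕ) :
    M / (-1 / τ).im * √((-1 / τ).im / (M / 2)) = ‖τ‖ * (M / τ.im * √(τ.im / (M / 2))) := by
  have hτ0 : τ ≠ 0 := fun h => by simp [h] at hτ
  have hn : 0 < ‖τ‖ := norm_pos_iff.2 hτ0
  rw [neg_one_div_im, normSq_eq_norm_sq, div_right_comm τ.im, Real.sqrt_div' _ (sq_nonneg _),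
    Real.sqrt_sq hn.le]
  field_simp

lemma conj_cpow_neg_half_mul {w : ℂ} (hw : 0 < w.re) :
    conj (w ^ (-(1 / 2 : ℂ))) * conj w = w ^ (-(1 / 2 : ℂ)) * ‖w‖ := by
  have hw0 : w ≠ 0 := fun h => by simp [h] at hw
  set r := w ^ (-(1 / 2 : ℂ)) with hr
  have hr0 : r ≠ 0 := by simp [hr, cpow_eq_zero_iff, hw0]
  have hrr : r * r * w = 1 := by
    rw [hr, ← cpow_add _ _ hw0, ← sub_eq_add_neg, ← neg_add', add_halves, cpow_neg_one,
      inv_mul_cancel₀ hw0]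
  have hn : ‖r‖ ^ 2 * ‖w‖ = 1 := by
    have := congrArg norm hrr
    rwa [norm_mul, norm_mul, norm_one, ← sq] at this
  have hn' : conj r * r * ‖w‖ = 1 := by
    rw [conj_mul']
    exact_mod_cast hn
  have hc : conj r * conj r * conj w = 1 := by
    rw [← map_mul, ← map_mul, hrr, map_one]
  refine mul_left_cancel₀ ((map_ne_zero conj).2 hr0) ?_
  linear_combination hc - hn'

lemma dbar_cancel {M : ℕ} (hM : 0 < M) (j s : ℤ) {τ : ℂ} (hτ : 0 < τ.im) (v : ℂ) :
    I / ((√(2 * ((M : ℝ) / 2)) : ℝ) : ℂ) * (-I * τ) ^ (-(1 / 2 : ℂ)) *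
        Complex.exp (2 * Real.pi * I * (M / 2) * v ^ 2 / τ) *
        ∑ i ∈ Finset.range M, Complex.exp (-(Real.pi : ℂ) * I * j * (s + i) / (M / 2)) *
          (I * ↑(M / (-1 / τ).im * √((-1 / τ).im / (M / 2))) *
            (Real.exp (-2 * Real.pi * M * (v / τ).im ^ 2 / (-1 / τ).im) *
              thetaResidue M (s + i) (-conj (-1 / τ)) (conj (v / τ))) * conj (τ⁻¹)) =
      -(I * ↑(M / τ.im * √(τ.im / (M / 2))) *
        (Real.exp (-2 * Real.pi * M * v.im ^ 2 / τ.im) *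
          thetaResidue M j (-conj τ) (conj v))) := by
  have hτ0 : τ ≠ 0 := fun h => by simp [h] at hτ
  have hτ0' : conj τ ≠ 0 := (map_ne_zero _).2 hτ0
  have hw : 0 < (-I * τ).re := by simpa using hτ
  have hcpow : (-I * -conj τ) ^ (-(1 / 2 : ℂ)) = conj ((-I * τ) ^ (-(1 / 2 : ℂ))) := by
    rw [show -I * -conj τ = conj (-I * τ) by simp, conj_cpow _ _ (slitPlane_arg_ne_pi (.inl hw)),
      map_neg, map_div₀, map_one, map_ofNat]
  have h1 := thetaResidue_functional_equation hM j s (τ := -conj τ) (by simpa using hτ) (conj v)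
  have e1 : -1 / -conj τ = -conj (-1 / τ) := by
    simp only [map_div₀, map_neg, map_one]
    field_simp
  have e2 : -conj v / -conj τ = conj (v / τ) := by
    rw [map_div₀, neg_div_neg_eq]
  rw [hcpow, e1, e2] at h1
  have h2 := gaussian_mul_exp_conj hτ M v
  have h3 := conj_cpow_neg_half_mul hw
  rw [norm_mul, norm_neg, norm_I, one_mul, map_mul, map_neg, conj_I, neg_neg] at h3
  rw [h1, gaussian_coeff_neg_one_div hτ, mul_div_cancel₀ _ two_ne_zero, ofReal_mul]
  have hsum (a b c : ℂ) (e θ : ℕ → ℂ) : ∑ i ∈ Finset.range M, e i * (a * (b * θ i) * c) =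
      a * b * c * ∑ i ∈ Finset.range M, e i * θ i := by
    rw [Finset.mul_sum]
    exact Finset.sum_congr rfl fun i _ => by ring
  rw [hsum]
  set r := (-I * τ) ^ (-(1 / 2 : ℂ))
  set Y := Complex.exp (2 * Real.pi * I * (M / 2) * v ^ 2 / τ)
  set E := Real.exp (-2 * Real.pi * M * (v / τ).im ^ 2 / (-1 / τ).im)
  set c := M / τ.im * √(τ.im / (M / 2))
  set S := ∑ i ∈ Finset.range M, Complex.exp (-(Real.pi : ℂ) * I * j * (s + i) / (M / 2)) *
    thetaResidue M (s + i) (-conj (-1 / τ)) (conj (v / τ))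
  rw [map_inv₀]
  linear_combination
    (-(I ^ 2 * (√(M : ℝ) : ℂ)⁻¹ * Y * E * c * S * (conj τ)⁻¹)) * h3 +
    (I ^ 3 * (√(M : ℝ) : ℂ)⁻¹ * Y * E * c * S * conj r) * inv_mul_cancel₀ hτ0' +
    (I * (√(M : ℝ) : ℂ)⁻¹ * c * S * conj r) * h2 +
    (I * (√(M : ℝ) : ℂ)⁻¹ * Y * E * c * S * conj r) * I_sq

end RSHolomorphy

/-- the function
`a_j^{++[s₁]}(τ,v) = -R^{+}_{j,m}(τ,v) - (i/√(2m)) (-iτ)^{-1/2} e^{2πimv²/τ}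
  Σ_{k ∈ ℤ, s₁ ≤ k < s₁+2m} e^{-πijk/m} R^{+}_{k,m}(-1/τ, v/τ)`
is holomorphic in `v` on all of `ℂ`, for each fixed `τ` with `Im τ > 0`; here
`m = m2/2 ∈ (1/2)ℤ_{>0}`, `j, s₁ ∈ ℤ`, the sum is over `k = s₁ + i`,
`i ∈ Finset.range m2.toNat`, and `(-iτ)^{-1/2}` is the principal branch. -/
theorem stmt18 (m2 : ℤ) (hm2 : 0 < m2) (j s₁ : ℤ) (τ : ℂ) (hτ : 0 < τ.im) :
    Differentiable ℂ (fun v : ℂ =>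
      -RS 1 (j : ℝ) ((m2 : ℝ) / 2) τ v -
        Complex.I / ((Real.sqrt (2 * ((m2 : ℝ) / 2)) : ℝ) : ℂ) *
          ((-Complex.I * τ) ^ (-(1 / 2 : ℂ))) *
          Complex.exp (2 * (Real.pi : ℂ) * Complex.I * ((m2 : ℂ) / 2) * v ^ 2 / τ) *
          ∑ i ∈ Finset.range m2.toNat,
            Complex.exp (-(Real.pi : ℂ) * Complex.I * (j : ℂ) * ((s₁ : ℂ) + (i : ℂ)) /
              ((m2 : ℂ) / 2)) *
            RS 1 ((s₁ : ℝ) + (i : ℝ)) ((m2 : ℝ) / 2) (-1 / τ) (v / τ)) := by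
  lift m2 to ℕ using hm2.le
  have hM : 0 < m2 := by exact_mod_cast hm2
  have hτ0 : τ ≠ 0 := fun h => by simp [h] at hτ
  have hτ' : 0 < (-1 / τ).im := by
    rw [RSHolomorphy.neg_one_div_im]
    exact div_pos hτ (Complex.normSq_pos.2 hτ0)
  intro v
  have hRS (i : ℕ) := ((RSHolomorphy.hasDbarAt_RS hM (s₁ + i) hτ' (v / τ)).comp
    (g := fun w => w / τ) ((hasDerivAt_id v).div_const τ)).mul_left
      (g := fun _ => Complex.exp (-(Real.pi : ℂ) * Complex.I * j * (s₁ + i) / (m2 / 2)))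
      (differentiableAt_const _)
  have h := (RSHolomorphy.hasDbarAt_RS hM j hτ v).neg.sub
    ((RSHolomorphy.HasDbarAt.sum (s := Finset.range m2) fun i _ => hRS i).mul_left
      (g := fun w => Complex.I / ((√(2 * ((m2 : ℝ) / 2)) : ℝ) : ℂ) *
        (-Complex.I * τ) ^ (-(1 / 2 : ℂ)) *
          Complex.exp (2 * Real.pi * Complex.I * (m2 / 2) * w ^ 2 / τ)) (by fun_prop))
  simp only [one_div τ] at h
  rw [RSHolomorphy.dbar_cancel hM j s₁ hτ v, sub_self] at h
  simpa only [Int.cast_natCast, Int.toNat_natCast, Int.cast_add] using h.differentiableAt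
end
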